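/- Let n be a positive integer, p ≥ 0 a real number, x a real number, and v, s integers with 1 ≤ v < s. Then H_{v,n}(s, p, x) = (p − x) · H_{v−1,n}(s, p, x) + p · e^{−np} · (np)^{s−1}/(s−1)! · h_{v−1,x}(s−1). -/

import Mathlib

open scoped BigOperators

/-- `h_{v,x}(y) = Σ_{l=0}^{v} binom(v,l) (-x)^{v-l} Π_{l'=0}^{l-1} ((y - l')/n)`. -/
noncomputable def hfun (n : ℕ) (x : ℝ) (v : ℕ) (y : ℝ) : ℝ :=
  ∑ l ∈ Finset.range (v + 1), (v.choose l : ℝ) * (-x) ^ (v - l) *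
    ∏ l' ∈ Finset.range l, ((y - l') / n)

/-- `H_{v,n}(s, p, x) = Σ_{l=0}^{v} binom(v,l)(-x)^{v-l} p^l Σ_{t=s-l}^{s-1} e^{-np}(np)^t/t!`. -/
noncomputable def Hfun (n : ℕ) (v s : ℕ) (p x : ℝ) : ℝ :=
  ∑ l ∈ Finset.range (v + 1), (v.choose l : ℝ) * (-x) ^ (v - l) * p ^ l *
    ∑ t ∈ Finset.Ico (s - l) s, Real.exp (-((n : ℝ) * p)) * ((n : ℝ) * p) ^ t / t.factorial

lemma aux_prod (n : ℕ) (hn : 0 < n) (p : ℝ) (m l : ℕ) (hl : l ≤ m) :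
    p ^ l * (((n : ℝ) * p) ^ (m - l) / (m - l).factorial)
      = ((n : ℝ) * p) ^ m / m.factorial * ∏ l' ∈ Finset.range l, (((m : ℝ) - l') / n) := by
  induction l with
  | zero => simp
  | succ k ih =>
    rw [Finset.prod_range_succ, ← mul_assoc, ← ih (by omega)]
    obtain ⟨j, rfl⟩ : ∃ j, m = j + (k + 1) := ⟨m - (k + 1), by omega⟩
    have h1 : j + (k + 1) - (k + 1) = j := by omega
    have h2 : j + (k + 1) - k = j + 1 := by omega
    rw [h1, h2, Nat.factorial_succ]
    have hn' : (n : ℝ) ≠ 0 := by positivity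
    have hj : (j.factorial : ℝ) ≠ 0 := by positivity
    have hj' : (j : ℝ) + 1 ≠ 0 := by positivity
    have h3 : (((j + (k + 1) : ℕ) : ℝ) - k) = j + 1 := by push_cast; ring
    rw [h3]
    push_cast
    field_simp
    ring

/-- For `1 ≤ v < s`:
`H_{v,n}(s,p,x) = (p-x) H_{v-1,n}(s,p,x) + p e^{-np} (np)^{s-1}/(s-1)! · h_{v-1,x}(s-1)`. -/
theorem Hfun_recursion (n : ℕ) (hn : 0 < n) (p : ℝ) (hp : 0 ≤ p) (x : ℝ)
    (v s : ℕ) (hv : 1 ≤ v) (hvs : v < s) :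
    Hfun n v s p x
      = (p - x) * Hfun n (v - 1) s p x
        + p * Real.exp (-((n : ℝ) * p)) * ((n : ℝ) * p) ^ (s - 1) / (s - 1).factorial *
          hfun n x (v - 1) ((s - 1 : ℕ) : ℝ) := by
  obtain ⟨w, rfl⟩ : ∃ w, v = w + 1 := ⟨v - 1, by omega⟩
  obtain ⟨m, rfl⟩ : ∃ m, s = m + 1 := ⟨s - 1, by omega⟩
  simp only [Nat.add_sub_cancel]
  unfold Hfun hfun
  have key := Finset.sum_choose_succ_mul (fun i j => (-x) ^ j * p ^ i *
    ∑ t ∈ Finset.Ico (m + 1 - i) (m + 1),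
      Real.exp (-((n : ℝ) * p)) * ((n : ℝ) * p) ^ t / t.factorial) w
  simp only [mul_assoc] at key ⊢
  rw [key, Finset.mul_sum, Finset.mul_sum, ← Finset.sum_add_distrib, ← Finset.sum_add_distrib]
  refine Finset.sum_congr rfl fun l hl => ?_
  have hl' : l ≤ w := by simpa [Nat.lt_succ_iff] using hl
  have e1 : w + 1 - l = (w - l) + 1 := by omega
  have e2 : m + 1 - (l + 1) = m - l := by omega
  have e3 : m + 1 - l = m - l + 1 := by omega
  rw [e1, e2, e3, Finset.sum_eq_sum_Ico_succ_bot (by omega : m - l < m + 1), pow_succ, pow_succ]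
  have h := aux_prod n hn p m l (by omega)
  generalize (∑ t ∈ Finset.Ico (m - l + 1) (m + 1), _ : ℝ) = S
  linear_combination ((w.choose l : ℝ) * (-x) ^ (w - l) * p * Real.exp (-((n : ℝ) * p))) * h
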